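/- arXiv:2408.11161 — 8 statements merged into one kernel-verified Lean document; each statement's English description precedes it below -/
import Mathlib

section
/- Let n be a positive integer, let s : Fin n → ℝ be the positions of n servers and r : Fin n → ℝ be the positions of n requests on the real line, and for a permutation π of Fin n let cost(π) = Σ_i |r i − s (π i)|. Suppose π is optimal, i.e. cost(π) ≤ cost(σ) for every permutation σ of Fin n. If for some indices i, j one has r i ≤ s (π j) and s (π j) < s (π i), then r j ≤ s (π j). -/
/-- Exchanging the images of two indices does not improve an optimal assignment. -/
theorem Equiv.Perm.add_le_add_of_sum_le {ι : Type*} [Fintype ι] [DecidableEq ι]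
    (c : ι → ι → ℝ) (π : Equiv.Perm ι)
    (hopt : ∀ σ : Equiv.Perm ι, ∑ k, c k (π k) ≤ ∑ k, c k (σ k)) {i j : ι} (hij : i ≠ j) :
    c i (π i) + c j (π j) ≤ c i (π j) + c j (π i) := by
  have hdiff : ∑ k, (c k ((π * Equiv.swap i j) k) - c k (π k)) =
      (c i (π j) - c i (π i)) + (c j (π i) - c j (π j)) := by
    rw [Fintype.sum_eq_add i j hij]
    · simp
    · rintro k ⟨hki, hkj⟩
      simp [Equiv.swap_apply_of_ne_of_ne hki hkj]
  rw [Finset.sum_sub_distrib] at hdiff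
  linarith [hopt (π * Equiv.swap i j)]

/-- Proposition 1 (first bullet): in an optimal matching on the line,
if `r i ≤ s (π j) < s (π i)` then `r j ≤ s (π j)`. -/
theorem optimal_matching_order_left (n : ℕ) (hn : 0 < n)
    (s r : Fin n → ℝ) (π : Equiv.Perm (Fin n))
    (hopt : ∀ σ : Equiv.Perm (Fin n),
      ∑ i, |r i - s (π i)| ≤ ∑ i, |r i - s (σ i)|)
    (i j : Fin n) (h1 : r i ≤ s (π j)) (h2 : s (π j) < s (π i)) :
    r j ≤ s (π j) := by
  by_contra! h
  have hij : i ≠ j := by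
    rintro rfl
    exact h2.false
  have hle := Equiv.Perm.add_le_add_of_sum_le (fun k l => |r k - s l|) π hopt hij
  have hlt : |r j - s (π i)| < (r j - s (π j)) + (s (π i) - s (π j)) :=
    abs_lt.mpr ⟨by linarith, by linarith⟩
  simp only [abs_of_nonpos (sub_nonpos.mpr h1), abs_of_nonpos (sub_nonpos.mpr (h1.trans h2.le)),
    abs_of_pos (sub_pos.mpr h)] at hle
  linarith
end

section
/- Let n be a positive integer, let s : Fin n → ℝ be the positions of n servers and r : Fin n → ℝ be the positions of n requests on the real line, and for a permutation π of Fin n let cost(π) = Σ_i |r i − s (π i)|. Suppose π is optimal, i.e. cost(π) ≤ cost(σ) for every permutation σ of Fin n. If for some indices i, j one has r i ≥ s (π j) and s (π j) > s (π i), then r j ≥ s (π j). -/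
/-- Proposition 1 (second bullet): in an optimal matching on the line,
if `r i ≥ s (π j) > s (π i)` then `r j ≥ s (π j)`. -/
theorem optimal_matching_order_right (n : ℕ) (hn : 0 < n)
    (s r : Fin n → ℝ) (π : Equiv.Perm (Fin n))
    (hopt : ∀ σ : Equiv.Perm (Fin n),
      ∑ i, |r i - s (π i)| ≤ ∑ i, |r i - s (σ i)|)
    (i j : Fin n) (h1 : r i ≥ s (π j)) (h2 : s (π j) > s (π i)) :
    r j ≥ s (π j) := by
  by_contra! hlt
  have hij : i ≠ j := by
    rintro rfl
    exact lt_irrefl _ h2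
  have hswap := hopt (π * Equiv.swap i j)
  rw [← sub_nonneg, ← Finset.sum_sub_distrib, Fintype.sum_eq_add i j hij] at hswap
  · simp only [Equiv.Perm.mul_apply, Equiv.swap_apply_left, Equiv.swap_apply_right] at hswap
    rw [abs_of_nonneg (sub_nonneg.2 h1), abs_of_nonneg (by linarith : 0 ≤ r i - s (π i)),
      abs_of_neg (sub_neg.2 hlt)] at hswap
    cases abs_cases (r j - s (π i)) <;> linarith
  · rintro k ⟨hki, hkj⟩
    simp [Equiv.swap_apply_of_ne_of_ne hki hkj]
end

section
/- Let n be a positive integer, s : Fin n → ℝ and r : Fin n → ℝ. Then there exists a permutation π of Fin n that is optimal (cost(π) = Σ_i |r i − s (π i)| is minimal among all permutations) and order-preserving in the sense that for all indices i, j, if r i < r j then s (π i) ≤ s (π j). -/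
/-- Precomposing with a swap of two distinct indices changes a sum only in the corresponding
two terms. -/
theorem sum_apply_swap_sub_sum {ι κ R : Type*} [Fintype ι] [DecidableEq ι] [AddCommGroup R]
    (g : ι → κ → R) (f : ι → κ) {i j : ι} (hij : i ≠ j) :
    ∑ k, g k (f (Equiv.swap i j k)) - ∑ k, g k (f k) =
      (g i (f j) - g i (f i)) + (g j (f i) - g j (f j)) := by
  rw [← Finset.sum_sub_distrib, Fintype.sum_eq_add i j hij]
  · simp
  · rintro k ⟨hki, hkj⟩
    rw [Equiv.swap_apply_of_ne_of_ne hki hkj, sub_self]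

/-- Uncrossing two pairs of points on the line does not increase the total distance. -/
theorem abs_sub_add_abs_sub_le_of_le {a b c d : ℝ} (hab : a ≤ b) (hcd : c ≤ d) :
    |a - c| + |b - d| ≤ |a - d| + |b - c| := by
  grind

/-- There exists an optimal matching on the line that is order-preserving:
requests in increasing order are matched to servers in weakly increasing order. -/
theorem exists_optimal_order_preserving_matching (n : ℕ) (hn : 0 < n)
    (s r : Fin n → ℝ) :
    ∃ π : Equiv.Perm (Fin n),
      (∀ σ : Equiv.Perm (Fin n),
        ∑ i, |r i - s (π i)| ≤ ∑ i, |r i - s (σ i)|) ∧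
      (∀ i j : Fin n, r i < r j → s (π i) ≤ s (π j)) := by
  -- Among the optimal matchings, take one maximizing `∑ i, r i * s (π i)`.
  obtain ⟨π, hπ⟩ := Finite.exists_min fun σ : Equiv.Perm (Fin n) =>
    toLex (∑ i, |r i - s (σ i)|, -∑ i, r i * s (σ i))
  simp only [Prod.Lex.toLex_le_toLex] at hπ
  refine ⟨π, fun σ => (hπ σ).elim le_of_lt fun h => h.1.le, fun i j hr => ?_⟩
  by_contra! hs
  have hij : i ≠ j := fun h => hr.ne (congrArg r h)
  have hcost := sum_apply_swap_sub_sum (fun k x => |r k - s x|) π hij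
  have hprod := sum_apply_swap_sub_sum (fun k x => r k * s x) π hij
  have huncross := abs_sub_add_abs_sub_le_of_le hr.le hs.le
  have hpos := mul_pos (sub_pos.2 hr) (sub_pos.2 hs)
  have hmin := hπ ((Equiv.swap i j).trans π)
  simp only [Equiv.trans_apply] at hmin
  rcases hmin with hlt | ⟨-, hle⟩
  · linarith
  · linarith
end

section
/- Let n be a positive integer and let s : Fin n → ℝ and r : Fin n → ℝ both be monotone nondecreasing (s i ≤ s j and r i ≤ r j whenever i ≤ j). Then the identity permutation is optimal: for every permutation σ of Fin n, Σ_i |r i − s i| ≤ Σ_i |r i − s (σ i)|. -/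
/-- If `i` is moved by `σ` and no smaller element is, then the permutation obtained from `σ` by
uncrossing at `i` (so that it fixes `i`) does not cost more than `σ`. -/
theorem sum_abs_sub_swap_mul_le {ι : Type*} [LinearOrder ι] [Fintype ι] {s r : ι → ℝ}
    (hs : Monotone s) (hr : Monotone r) {σ : Equiv.Perm ι} {i : ι} (hi : σ i ≠ i)
    (hmin : ∀ j, σ j ≠ j → i ≤ j) :
    ∑ k, |r k - s ((Equiv.swap i (σ i) * σ) k)| ≤ ∑ k, |r k - s (σ k)| := by
  obtain ⟨j, hj⟩ := σ.surjective i
  have hne : i ≠ j := by rintro rfl; exact hi hj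
  have hij : r i ≤ r j := hr (hmin j (hj.trans_ne hne))
  have hiσ : s i ≤ s (σ i) := hs (hmin (σ i) fun h => hi (σ.injective h))
  rw [← sub_nonneg, ← Finset.sum_sub_distrib, Fintype.sum_eq_add i j hne]
  · have := abs_sub_add_abs_sub_le_of_le hij hiσ
    simp only [Equiv.Perm.mul_apply, Equiv.swap_apply_right, hj, Equiv.swap_apply_left]
    linarith
  · rintro k ⟨hki, hkj⟩
    rw [Equiv.Perm.mul_apply, Equiv.swap_apply_of_ne_of_ne, sub_self]
    · exact fun h => hkj (σ.injective (h.trans hj.symm))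
    · exact fun h => hki (σ.injective h)

/-- The identity matching between two sorted families is optimal, over any finite linear order. -/
theorem sum_abs_sub_le_sum_abs_sub_comp_perm {ι : Type*} [LinearOrder ι] [Fintype ι] {s r : ι → ℝ}
    (hs : Monotone s) (hr : Monotone r) (σ : Equiv.Perm ι) :
    ∑ i, |r i - s i| ≤ ∑ i, |r i - s (σ i)| := by
  induction h : σ.support.card using Nat.strong_induction_on generalizing σ with
  | _ m ih =>
    subst h
    rcases σ.support.eq_empty_or_nonempty with hσ | hσ
    · rw [Equiv.Perm.support_eq_empty_iff.mp hσ]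
      rfl
    · have hi := Equiv.Perm.mem_support.mp (σ.support.min'_mem hσ)
      exact (ih _ (Equiv.Perm.card_support_swap_mul hi) _ rfl).trans
        (sum_abs_sub_swap_mul_le hs hr hi fun j hj =>
          σ.support.min'_le j (Equiv.Perm.mem_support.mpr hj))

/-- If the servers and requests are both sorted nondecreasingly, then the identity
matching is optimal. -/
theorem identity_matching_optimal (n : ℕ) (hn : 0 < n)
    (s r : Fin n → ℝ) (hs : Monotone s) (hr : Monotone r) :
    ∀ σ : Equiv.Perm (Fin n),
      ∑ i, |r i - s i| ≤ ∑ i, |r i - s (σ i)| :=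
  sum_abs_sub_le_sum_abs_sub_comp_perm hs hr
end

section
/- Let n ≥ 2, let s : Fin n → ℝ be strictly increasing server positions, and let r : Fin n → ℝ be request positions. Suppose there is an index m such that r i < r m for all i ≠ m, and suppose s (n−2) < r m ≤ s (n−1) (i.e. the strictly largest request lies strictly to the right of the second-largest server and at most at the largest server). Then every optimal permutation π (minimizing Σ_i |r i − s (π i)|) satisfies π m = n−1, i.e. the largest request is matched to the largest server. -/
/-- If the strictly largest request lies strictly to the right of the second-largest
server and at most at the largest server, then every optimal matching matches it to
the largest server. -/
theorem largest_request_matched_to_largest_server (n : ℕ) (hn : 2 ≤ n)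
    (s r : Fin n → ℝ) (hs : StrictMono s)
    (m : Fin n) (hm : ∀ i : Fin n, i ≠ m → r i < r m)
    (h1 : s ⟨n - 2, by omega⟩ < r m) (h2 : r m ≤ s ⟨n - 1, by omega⟩)
    (π : Equiv.Perm (Fin n))
    (hopt : ∀ σ : Equiv.Perm (Fin n),
      ∑ i, |r i - s (π i)| ≤ ∑ i, |r i - s (σ i)|) :
    π m = ⟨n - 1, by omega⟩ := by
  by_contra hne
  set l : Fin n := ⟨n - 1, by omega⟩ with hl
  set k := π.symm l with hk
  have hπk : π k = l := π.apply_symm_apply l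
  have hkm : k ≠ m := fun h => hne (h ▸ hπk)
  have hsm : s (π m) ≤ s ⟨n - 2, by omega⟩ := by
    refine hs.monotone (Fin.le_def.2 ?_)
    have hval : (π m : ℕ) ≠ n - 1 := fun h => hne (Fin.ext h)
    have hlt := (π m).isLt
    simp only
    omega
  have hsum := Fintype.sum_eq_add
    (f := fun i => |r i - s ((Equiv.swap m k).trans π i)| - |r i - s (π i)|) m k hkm.symm
    fun i hi => by simp [Equiv.swap_apply_of_ne_of_ne hi.1 hi.2]
  simp only [Finset.sum_sub_distrib, Equiv.trans_apply, Equiv.swap_apply_left,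
    Equiv.swap_apply_right, hπk] at hsum
  have hle := hopt ((Equiv.swap m k).trans π)
  simp only [Equiv.trans_apply] at hle
  have hrk := hm k hkm
  have hm_old : |r m - s (π m)| = r m - s (π m) := abs_of_pos (by linarith)
  have hm_new : |r m - s l| = -(r m - s l) := abs_of_nonpos (by linarith)
  have hk_old : |r k - s l| = -(r k - s l) := abs_of_nonpos (by linarith)
  have hk_new : |r k - s (π m)| < 2 * r m - r k - s (π m) :=
    abs_lt.2 ⟨by linarith, by linarith⟩
  linarith
end

section
/- Let n be a positive integer. Consider servers s_i = i for i = 1, …, n and requests r_i = n − 2^{−i} for i = 1, …, n (formally, s, r : Fin n → ℝ with s i = i + 1 and r i = n − 2^{−(i+1)}). Then in every optimal matching (every permutation π minimizing Σ_i |r i − s (π i)|), the last request r_n is matched to the last server s_n = n. -/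
/-- If every request lies to the right of all servers but `s l`, and to the left of `s l`,
then a matching's cost is a constant plus twice the distance from `s l` to its request. -/
theorem sum_abs_sub_perm_eq {ι : Type*} [Fintype ι] (s r : ι → ℝ) (l : ι)
    (hle : ∀ i, r i ≤ s l) (hge : ∀ i k, k ≠ l → s k ≤ r i) (σ : Equiv.Perm ι) :
    ∑ i, |r i - s (σ i)| = ∑ i, r i - ∑ i, s i + 2 * (s l - r (σ.symm l)) := by
  classical
  have hterm (i : ι) : |r i - s (σ i)| =
      r i - s (σ i) + if σ.symm l = i then 2 * (s l - r i) else 0 := by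
    split_ifs with h
    · have hi : σ i = l := by rw [← h, σ.apply_symm_apply]
      rw [hi, abs_of_nonpos (sub_nonpos.2 (hle i))]
      ring
    · have hi : σ i ≠ l := fun hi => h (by rw [← hi, σ.symm_apply_apply])
      rw [abs_of_nonneg (sub_nonneg.2 (hge i _ hi)), add_zero]
  simp only [hterm, Finset.sum_add_distrib, Finset.sum_sub_distrib, Finset.sum_ite_eq,
    Finset.mem_univ, if_true, Equiv.sum_comp σ s]

/-- For the special instance with servers `s_i = i` and requests `r_i = n - 2^{-i}`
(`i = 1, …, n`), every optimal matching matches the last request to the last server. -/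
theorem rho0_last_request_to_last_server (n : ℕ) (hn : 0 < n)
    (s r : Fin n → ℝ)
    (hs : ∀ i : Fin n, s i = (i : ℝ) + 1)
    (hr : ∀ i : Fin n, r i = (n : ℝ) - (2 : ℝ) ^ (-((i : ℤ) + 1)))
    (π : Equiv.Perm (Fin n))
    (hopt : ∀ σ : Equiv.Perm (Fin n),
      ∑ i, |r i - s (π i)| ≤ ∑ i, |r i - s (σ i)|) :
    π ⟨n - 1, by omega⟩ = ⟨n - 1, by omega⟩ := by
  set l : Fin n := ⟨n - 1, by omega⟩ with hl
  have hsl : s l = n := by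
    rw [hs, hl]
    exact_mod_cast Nat.sub_add_cancel hn
  have hle (i : Fin n) : r i ≤ s l := by
    rw [hsl, hr]
    exact sub_le_self _ (by positivity)
  have hge (i k : Fin n) (hk : k ≠ l) : s k ≤ r i := by
    have hkn : (k : ℕ) + 2 ≤ n := by
      have := Fin.val_ne_of_ne hk
      simp only [hl] at this
      omega
    have hkn' : (k : ℝ) + 2 ≤ n := by exact_mod_cast hkn
    have hpow : (2 : ℝ) ^ (-((i : ℤ) + 1)) ≤ 1 :=
      zpow_le_one_of_nonpos₀ one_le_two (by omega)
    rw [hs, hr]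
    linarith
  have hmin := hopt (Equiv.refl _)
  rw [sum_abs_sub_perm_eq s r l hle hge, sum_abs_sub_perm_eq s r l hle hge,
    Equiv.refl_symm, Equiv.refl_apply, hr, hr] at hmin
  have hpow : (2 : ℝ) ^ (-(((π.symm l : Fin n) : ℤ) + 1)) ≤ 2 ^ (-((l : ℤ) + 1)) := by
    linarith
  rw [zpow_le_zpow_iff_right₀ one_lt_two] at hpow
  have hj : π.symm l = l := by
    ext
    have := (π.symm l).isLt
    simp only [hl] at hpow this ⊢
    omega
  exact (π.symm_apply_eq.1 hj).symm
end

section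
/- Let n and k be integers with 1 ≤ k < n. Consider servers s_i = i for i = 1, …, n, and requests r : {1, …, n} → ℝ satisfying r_i = n − 2^{−i} for 1 ≤ i ≤ n − k and 0 < r_i ≤ k for n − k < i ≤ n. Then in every optimal matching (every permutation π minimizing Σ_i |r_i − s_{π(i)}|), the request r_{n−k} is matched to the last server s_n = n. -/
/-- If two requests `r q < r p` satisfy `s (π p) < r p < s (π q)`, then exchanging their servers
strictly decreases the cost of the matching `π` on the line. -/
theorem sum_abs_sub_mul_swap_lt {ι : Type*} [Fintype ι] [DecidableEq ι] (r s : ι → ℝ)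
    (π : Equiv.Perm ι) {p q : ι} (hqp : r q < r p) (hp : s (π p) < r p) (hq : r p < s (π q)) :
    ∑ i, |r i - s ((π * Equiv.swap p q) i)| < ∑ i, |r i - s (π i)| := by
  have hne : p ≠ q := by rintro rfl; exact lt_irrefl _ hqp
  have hsum : ∑ i, (|r i - s (π i)| - |r i - s ((π * Equiv.swap p q) i)|) =
      (|r p - s (π p)| - |r p - s (π q)|) + (|r q - s (π q)| - |r q - s (π p)|) := by
    rw [Fintype.sum_eq_add p q hne]
    · simp
    · rintro i ⟨hip, hiq⟩
      simp [Equiv.swap_apply_of_ne_of_ne hip hiq]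
  rw [Finset.sum_sub_distrib, abs_of_pos (sub_pos.2 hp), abs_of_neg (sub_neg.2 hq),
    abs_of_neg (sub_neg.2 (hqp.trans hq))] at hsum
  have hqa : |r q - s (π p)| < 2 * r p - r q - s (π p) := by
    rw [abs_lt]
    constructor <;> linarith
  linarith


/-- Lower-bound construction instance: servers `s_i = i` (`i = 1, …, n`), the first
`n - k` requests follow `r_i = n - 2^{-i}` and the remaining `k` requests lie in
`(0, k]`. Then every optimal matching matches request `r_{n-k}` to the last server
`s_n = n`. (Indices are 1-based in the informal statement; here `Fin n` index `i`
corresponds to the informal index `i + 1`.) -/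
theorem prefix_rho0_request_to_last_server (n k : ℕ) (hk : 1 ≤ k) (hkn : k < n)
    (s r : Fin n → ℝ)
    (hs : ∀ i : Fin n, s i = (i : ℝ) + 1)
    (hr1 : ∀ i : Fin n, (i : ℕ) + 1 ≤ n - k →
      r i = (n : ℝ) - (2 : ℝ) ^ (-((i : ℤ) + 1)))
    (hr2 : ∀ i : Fin n, n - k < (i : ℕ) + 1 → 0 < r i ∧ r i ≤ (k : ℝ))
    (π : Equiv.Perm (Fin n))
    (hopt : ∀ σ : Equiv.Perm (Fin n),
      ∑ i, |r i - s (π i)| ≤ ∑ i, |r i - s (σ i)|) :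
    π ⟨n - k - 1, by omega⟩ = ⟨n - 1, by omega⟩ := by
  by_contra hne
  set p : Fin n := ⟨n - k - 1, by omega⟩ with hp
  obtain ⟨q, hq⟩ := π.surjective ⟨n - 1, by omega⟩
  have hpq : q ≠ p := by rintro rfl; exact hne hq
  have hpv : (p : ℕ) + 1 = n - k := by simp only [hp]; omega
  have hrp := hr1 p hpv.le
  have hpos : (0 : ℝ) < 2 ^ (-((p : ℤ) + 1)) := by positivity
  have hlt_one : (2 : ℝ) ^ (-((p : ℤ) + 1)) < 1 :=
    zpow_lt_one_of_neg₀ one_lt_two (by omega)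
  have hkn' : (k : ℝ) + 1 ≤ n := by exact_mod_cast hkn
  have hsq : s (π q) = n := by
    rw [hq, hs]
    exact_mod_cast Nat.sub_add_cancel (by omega : 1 ≤ n)
  have hsp : s (π p) + 1 ≤ n := by
    have hval : (π p : ℕ) ≠ n - 1 := fun h => hne (Fin.ext h)
    have hle : (π p : ℕ) + 1 + 1 ≤ n := by have := (π p).isLt; omega
    rw [hs]
    exact_mod_cast hle
  have hrq : r q < r p := by
    rcases le_or_gt ((q : ℕ) + 1) (n - k) with h | h
    · have hval : (q : ℕ) ≠ p := fun h => hpq (Fin.ext h)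
      have hpow : (2 : ℝ) ^ (-((p : ℤ) + 1)) < 2 ^ (-((q : ℤ) + 1)) :=
        zpow_lt_zpow_right₀ one_lt_two (by omega)
      rw [hrp, hr1 q h]
      linarith
    · linarith [(hr2 q h).2]
  exact (sum_abs_sub_mul_swap_lt r s π hrq (by linarith) (by linarith)).not_ge (hopt _)
end

section
/- Let n be a positive integer, s : Fin n → ℝ, r : Fin n → ℝ, and define the rescaled input by s' i = n³·(s i − s 0) + 1 and r' i = ⌊n³·(r i − s 0)⌋ + 1 (where s 0 denotes the position of the first server and ⌊·⌋ is the integer floor, viewed in ℝ). Then for every permutation π of Fin n, | Σ_i |r' i − s' (π i)| − n³ · Σ_i |r i − s (π i)| | ≤ n. -/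
/-- Rescaling lemma for algorithm RESCALE: with `s' i = n³ (s i - s 0) + 1` and
`r' i = ⌊n³ (r i - s 0)⌋ + 1`, the cost of any fixed matching changes by at most `n`
after scaling by `n³`. -/
theorem rescale_cost_close (n : ℕ) (hn : 0 < n)
    (s r : Fin n → ℝ) (π : Equiv.Perm (Fin n))
    (s' r' : Fin n → ℝ)
    (hs' : ∀ i, s' i = (n : ℝ) ^ 3 * (s i - s ⟨0, hn⟩) + 1)
    (hr' : ∀ i, r' i = (⌊(n : ℝ) ^ 3 * (r i - s ⟨0, hn⟩)⌋ : ℝ) + 1) :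
    abs ((∑ i, |r' i - s' (π i)|) - (n : ℝ) ^ 3 * ∑ i, |r i - s (π i)|) ≤ (n : ℝ) := by
  rw [Finset.mul_sum, ← Finset.sum_sub_distrib]
  have termwise : ∀ i, |(|r' i - s' (π i)| - (n : ℝ) ^ 3 * |r i - s (π i)|)| ≤ 1 := by
    intro i
    have scale : (n : ℝ) ^ 3 * |r i - s (π i)| = |(n : ℝ) ^ 3 * (r i - s (π i))| := by
      rw [abs_mul, abs_of_nonneg (by positivity : (0 : ℝ) ≤ (n : ℝ) ^ 3)]
    rw [scale]
    refine (abs_abs_sub_abs_le _ _).trans ?_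
    have floor_le := Int.floor_le ((n : ℝ) ^ 3 * (r i - s ⟨0, hn⟩))
    have lt_floor := Int.lt_floor_add_one ((n : ℝ) ^ 3 * (r i - s ⟨0, hn⟩))
    rw [hr', hs', abs_le]
    constructor <;> linarith
  calc
    |∑ i, (|r' i - s' (π i)| - (n : ℝ) ^ 3 * |r i - s (π i)|)|
        ≤ ∑ i, |(|r' i - s' (π i)| - (n : ℝ) ^ 3 * |r i - s (π i)|)| :=
      Finset.abs_sum_le_sum_abs _ _
    _ ≤ ∑ _i : Fin n, (1 : ℝ) := Finset.sum_le_sum fun i _ => termwise i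
    _ = n := by simp
end
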